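/- arXiv:math/0212250 — 3 statements merged into one kernel-verified Lean document; each statement's English description precedes it below -/
import Mathlib

section
/- For every U ⊆ 2^ω and every finite u ⊆ 2^ω ∖ U: G_{U,u} is a subgroup of G_{U∪u}; moreover G_{U,u} is a pure subgroup of G_{U∪u}, and G_{U∪u} is a pure subgroup of G_k. -/
/-- The generators of the abelian group `G_k`: `x_{m,η̄,ν}` with `m ≤ k`,
`η̄ : ({0,…,k} ∖ {m}) → 2^ω` and `ν ∈ 2^{<ω}`, and `y_{η̄,n}` with
`η̄ : {0,…,k} → 2^ω` and `n ∈ ℕ`. -/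
inductive Gen (k : ℕ) where
  | x (m : Fin (k + 1)) (η : {ℓ : Fin (k + 1) // ℓ ≠ m} → ℕ → Bool) (ν : List Bool)
  | y (η : Fin (k + 1) → ℕ → Bool) (n : ℕ)

/-- The defining relation of `G_k` for `η̄ ∈ (2^ω)^{k+1}` and `n`, as an element of the
free abelian group on the generators:
`n!·y_{η̄,n+1} - y_{η̄,n} - Σ_{m ≤ k} x_{m, η̄↾({0,…,k}∖{m}), η_m↾n}`. -/
def relGk (k : ℕ) (η : Fin (k + 1) → ℕ → Bool) (n : ℕ) : FreeAbelianGroup (Gen k) :=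
  (n.factorial : ℤ) • FreeAbelianGroup.of (Gen.y η (n + 1))
    - FreeAbelianGroup.of (Gen.y η n)
    - ∑ m : Fin (k + 1),
        FreeAbelianGroup.of (Gen.x m (fun ℓ => η ℓ.1) ((List.range n).map (η m)))

/-- The subgroup of relations defining `G_k`. -/
def relSubgroup (k : ℕ) : AddSubgroup (FreeAbelianGroup (Gen k)) :=
  AddSubgroup.closure {z | ∃ η n, z = relGk k η n}

/-- The abelian group `G_k`, presented by the generators `Gen k` and the relations
`n!·y_{η̄,n+1} = y_{η̄,n} + Σ_{m ≤ k} x_{m, η̄↾({0,…,k}∖{m}), η_m↾n}`. -/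
abbrev Gk (k : ℕ) : Type := FreeAbelianGroup (Gen k) ⧸ relSubgroup k

/-- The image in `G_k` of a generator. -/
def genMk (k : ℕ) (g : Gen k) : Gk k :=
  QuotientAddGroup.mk (FreeAbelianGroup.of g)

/-- The generators all of whose `2^ω`-indices lie in `U`. -/
def genIn (k : ℕ) (U : Set (ℕ → Bool)) : Set (Gen k) :=
  {g | match g with
    | .x _ η _ => ∀ ℓ, η ℓ ∈ U
    | .y η _ => ∀ ℓ, η ℓ ∈ U}

/-- The subgroup `G_U` of `G_k` generated by the generators whose indices all lie
in `U`. -/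
def GU (k : ℕ) (U : Set (ℕ → Bool)) : AddSubgroup (Gk k) :=
  AddSubgroup.closure (genMk k '' genIn k U)

/-- The subgroup `G_{U,u}` of `G_k` generated by the union of the subgroups
`G_{U ∪ (u ∖ {η})}` for `η ∈ u`. -/
def GUu (k : ℕ) (U u : Set (ℕ → Bool)) : AddSubgroup (Gk k) :=
  ⨆ η ∈ u, GU k (U ∪ (u \ {η}))

/-- A set of generators is saturated if, together with any `y_{η̄,n}`, it contains every generator
occurring in the relations indexed by `η̄`. -/
def Saturated (k : ℕ) (S : Set (Gen k)) : Prop :=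
  ∀ η n, Gen.y η n ∈ S →
    (∀ n', Gen.y η n' ∈ S) ∧ ∀ m ν, Gen.x m (fun ℓ => η ℓ.1) ν ∈ S

open Classical in
/-- The basis vector of a generator outside `S`, and `0` for a generator in `S`. -/
noncomputable def basisVec (k : ℕ) (S : Set (Gen k)) (g : Gen k) : Gen k → ℚ :=
  if g ∈ S then 0 else Pi.single g 1

/-- The image of `y_{η̄,n}` in the rational vector space spanned by the `x`'s and the `y_{η̄,0}`
outside `S`, obtained by solving the defining relations for `y_{η̄,n}`. -/
noncomputable def yVec (k : ℕ) (S : Set (Gen k)) (η : Fin (k + 1) → ℕ → Bool) :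
    ℕ → Gen k → ℚ
  | 0 => basisVec k S (.y η 0)
  | n + 1 => (n.factorial : ℚ)⁻¹ • (yVec k S η n
      + ∑ m : Fin (k + 1), basisVec k S (.x m (fun ℓ => η ℓ.1) ((List.range n).map (η m))))

/-- The image of a generator in the rational vector space in which the quotient of `G_k` by the
subgroup generated by `S` embeds. -/
noncomputable def genVec (k : ℕ) (S : Set (Gen k)) : Gen k → Gen k → ℚ
  | .x m η ν => basisVec k S (.x m η ν)
  | .y η n => yVec k S η n

/-- The homomorphism from `G_k` to a rational vector space extending `genVec`. -/
noncomputable def toVec (k : ℕ) (S : Set (Gen k)) : Gk k →+ (Gen k → ℚ) :=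
  QuotientAddGroup.lift (relSubgroup k) (FreeAbelianGroup.lift (genVec k S)) <| by
    rw [relSubgroup, AddSubgroup.closure_le]
    rintro _ ⟨η, n, rfl⟩
    have hn : (n.factorial : ℚ) ≠ 0 := by exact_mod_cast n.factorial_ne_zero
    simp only [SetLike.mem_coe, AddMonoidHom.mem_ker, relGk, map_sub, map_zsmul, map_sum,
      FreeAbelianGroup.lift_apply_of, genVec, yVec]
    rw [← Int.cast_smul_eq_zsmul ℚ, smul_smul]
    push_cast
    rw [mul_inv_cancel₀ hn, one_smul]
    abel

theorem toVec_genMk (k : ℕ) (S : Set (Gen k)) (g : Gen k) :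
    toVec k S (genMk k g) = genVec k S g := by
  simp [toVec, genMk]

theorem basisVec_of_mem {k : ℕ} {S : Set (Gen k)} {g : Gen k} (hg : g ∈ S) :
    basisVec k S g = 0 := by
  simp [basisVec, hg]

theorem basisVec_apply_self {k : ℕ} {S : Set (Gen k)} {g : Gen k} (hg : g ∉ S) :
    basisVec k S g g = 1 := by
  simp [basisVec, hg]

theorem basisVec_apply_of_ne {k : ℕ} {S : Set (Gen k)} {g g' : Gen k} (h : g' ≠ g) :
    basisVec k S g g' = 0 := by
  unfold basisVec
  split_ifs
  · rfl
  · simp [h]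

theorem Saturated.genVec_of_mem {k : ℕ} {S : Set (Gen k)} (hS : Saturated k S) {g : Gen k}
    (hg : g ∈ S) : genVec k S g = 0 := by
  cases g with
  | x m η ν => exact basisVec_of_mem hg
  | y η n =>
    obtain ⟨hy, hx⟩ := hS η n hg
    clear hg
    change yVec k S η n = 0
    induction n with
    | zero => exact basisVec_of_mem (hy 0)
    | succ n ih => simp [yVec, ih, basisVec_of_mem (hx _ _)]

theorem yVec_apply_y_of_ne {k : ℕ} (S : Set (Gen k)) {η η' : Fin (k + 1) → ℕ → Bool}
    (h : η' ≠ η) (n : ℕ) : yVec k S η n (.y η' 0) = 0 := by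
  induction n with
  | zero => exact basisVec_apply_of_ne (by simpa using h)
  | succ n ih => simp [yVec, ih, basisVec_apply_of_ne]

theorem yVec_apply_y_self {k : ℕ} {S : Set (Gen k)} {η : Fin (k + 1) → ℕ → Bool}
    (h : Gen.y η 0 ∉ S) (n : ℕ) : yVec k S η n (.y η 0) ≠ 0 := by
  induction n with
  | zero => simp [yVec, basisVec_apply_self h]
  | succ n ih => simp [yVec, ih, basisVec_apply_of_ne, Nat.factorial_ne_zero]

/-- All the `x`'s together with the `y_{η̄,N}` for a fixed `N`. -/
def level (k N : ℕ) : Set (Gen k) :=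
  {g | match g with
    | .x _ _ _ => True
    | .y _ n => n = N}

theorem genMk_y (k : ℕ) (η : Fin (k + 1) → ℕ → Bool) (n : ℕ) :
    genMk k (.y η n) = (n.factorial : ℤ) • genMk k (.y η (n + 1))
      - ∑ m : Fin (k + 1), genMk k (.x m (fun ℓ => η ℓ.1) ((List.range n).map (η m))) := by
  have h : (QuotientAddGroup.mk' (relSubgroup k)) (relGk k η n) = 0 :=
    (QuotientAddGroup.eq_zero_iff _).2 (AddSubgroup.subset_closure ⟨η, n, rfl⟩)
  simp only [relGk, map_sub, map_zsmul, map_sum] at h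
  rw [sub_right_comm, sub_eq_zero] at h
  exact h.symm

theorem span_level_mono (k : ℕ) :
    Monotone fun N => Submodule.span ℤ (genMk k '' level k N) := by
  refine monotone_nat_of_le_succ fun N => Submodule.span_le.2 ?_
  rintro _ ⟨g, hg, rfl⟩
  cases g with
  | x m η ν => exact Submodule.subset_span ⟨.x _ _ _, trivial, rfl⟩
  | y η n =>
    obtain rfl : n = N := hg
    rw [genMk_y]
    exact sub_mem (Submodule.smul_mem _ _ (Submodule.subset_span ⟨_, rfl, rfl⟩))
      (sum_mem fun m _ => Submodule.subset_span ⟨.x _ _ _, trivial, rfl⟩)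

theorem exists_mem_span_level (k : ℕ) (g : Gk k) :
    ∃ N, g ∈ Submodule.span ℤ (genMk k '' level k N) := by
  obtain ⟨z, rfl⟩ := QuotientAddGroup.mk_surjective g
  induction z using FreeAbelianGroup.induction_on with
  | zero => exact ⟨0, zero_mem _⟩
  | of g =>
    cases g with
    | x m η ν => exact ⟨0, Submodule.subset_span ⟨.x _ _ _, trivial, rfl⟩⟩
    | y η n => exact ⟨n, Submodule.subset_span ⟨_, rfl, rfl⟩⟩
  | neg g ih =>
    obtain ⟨N, hN⟩ := ih
    exact ⟨N, neg_mem hN⟩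
  | add a b iha ihb =>
    obtain ⟨M, hM⟩ := iha
    obtain ⟨N, hN⟩ := ihb
    exact ⟨max M N, add_mem (span_level_mono k (le_max_left M N) hM)
      (span_level_mono k (le_max_right M N) hN)⟩

/-- The kernel of `toVec` is contained in the subgroup generated by `S`. -/
theorem Saturated.mem_closure_of_toVec_eq_zero {k : ℕ} {S : Set (Gen k)} (hS : Saturated k S)
    {g : Gk k} (hg : toVec k S g = 0) : g ∈ AddSubgroup.closure (genMk k '' S) := by
  obtain ⟨N, hN⟩ := exists_mem_span_level k g
  obtain ⟨z, hz, rfl⟩ := (Finsupp.mem_span_image_iff_linearCombination ℤ).1 hN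
  rw [Finsupp.mem_supported] at hz
  have hsum (c : Gen k) : ∑ b ∈ z.support, (z b : ℚ) * genVec k S b c = 0 := by
    have := congrFun hg c
    simpa [Finsupp.linearCombination_apply, Finsupp.sum, map_sum, map_zsmul, toVec_genMk,
      Finset.sum_apply] using this
  have hy (η) (n) (hmem : Gen.y η n ∉ S) : z (.y η n) = 0 := by
    by_contra hne
    obtain rfl : n = N := hz (Finsupp.mem_support_iff.2 hne)
    have h0 : Gen.y η 0 ∉ S := fun h => hmem ((hS η 0 h).1 n)
    have := hsum (.y η 0)
    rw [Finset.sum_eq_single_of_mem (.y η n) (Finsupp.mem_support_iff.2 hne)] at this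
    · rcases mul_eq_zero.1 this with h | h
      · exact hne (by exact_mod_cast h)
      · exact yVec_apply_y_self h0 n h
    · intro b hb hbne
      cases b with
      | x m η' ν => simp [genVec, basisVec_apply_of_ne]
      | y η' n' =>
        obtain rfl : n' = n := hz hb
        have : η ≠ η' := fun h => hbne (by rw [h])
        simp [genVec, yVec_apply_y_of_ne S this]
  have hx (m η ν) (hmem : Gen.x m η ν ∉ S) : z (.x m η ν) = 0 := by
    by_contra hne
    have := hsum (.x m η ν)
    rw [Finset.sum_eq_single_of_mem (.x m η ν) (Finsupp.mem_support_iff.2 hne)] at this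
    · simp [genVec, basisVec_apply_self hmem, hne] at this
    · intro b _ hbne
      cases b with
      | x m' η' ν' => simp [genVec, basisVec_apply_of_ne hbne.symm]
      | y η' n' =>
        by_cases hb : Gen.y η' n' ∈ S
        · simp [hS.genVec_of_mem hb]
        · simp [hy _ _ hb]
  rw [Finsupp.linearCombination_apply]
  refine sum_mem fun b hb => zsmul_mem (AddSubgroup.subset_closure (Set.mem_image_of_mem _ ?_)) _
  by_contra hbS
  refine Finsupp.mem_support_iff.1 hb ?_
  cases b with
  | x m η ν => exact hx m η ν hbS
  | y η n => exact hy η n hbS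

/-- The quotient of `G_k` by the subgroup generated by a saturated set is torsion-free. -/
theorem Saturated.mem_closure_of_zsmul_mem {k : ℕ} {S : Set (Gen k)} (hS : Saturated k S)
    {n : ℤ} (hn : n ≠ 0) {g : Gk k} (hg : n • g ∈ AddSubgroup.closure (genMk k '' S)) :
    g ∈ AddSubgroup.closure (genMk k '' S) := by
  have hker : AddSubgroup.closure (genMk k '' S) ≤ (toVec k S).ker := by
    rw [AddSubgroup.closure_le]
    rintro _ ⟨s, hs, rfl⟩
    simp [toVec_genMk, hS.genVec_of_mem hs]
  have h : toVec k S (n • g) = 0 := hker hg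
  rw [map_zsmul, smul_eq_zero] at h
  exact hS.mem_closure_of_toVec_eq_zero (h.resolve_left hn)

theorem Saturated.pure_closure {k : ℕ} {S : Set (Gen k)} (hS : Saturated k S) (n : ℤ)
    {g : Gk k} (hg : n • g ∈ AddSubgroup.closure (genMk k '' S)) :
    ∃ h' ∈ AddSubgroup.closure (genMk k '' S), n • g = n • h' := by
  rcases eq_or_ne n 0 with rfl | hn
  · exact ⟨0, zero_mem _, by simp⟩
  · exact ⟨g, hS.mem_closure_of_zsmul_mem hn hg, rfl⟩

theorem saturated_genIn (k : ℕ) (U : Set (ℕ → Bool)) : Saturated k (genIn k U) :=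
  fun _ _ h => ⟨fun _ => h, fun _ _ ℓ => h ℓ.1⟩

theorem Saturated.biUnion {k : ℕ} {ι : Type*} {I : Set ι} {S : ι → Set (Gen k)}
    (hS : ∀ i, Saturated k (S i)) : Saturated k (⋃ i ∈ I, S i) := by
  intro η n h
  simp only [Set.mem_iUnion, exists_prop] at h ⊢
  obtain ⟨i, hi, h⟩ := h
  exact ⟨fun n' => ⟨i, hi, (hS i η n h).1 n'⟩, fun m ν => ⟨i, hi, (hS i η n h).2 m ν⟩⟩

theorem GUu_eq_closure (k : ℕ) (U u : Set (ℕ → Bool)) :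
    GUu k U u = AddSubgroup.closure (genMk k '' ⋃ η ∈ u, genIn k (U ∪ (u \ {η}))) := by
  simp only [GUu, GU, Set.image_iUnion, AddSubgroup.closure_iUnion]

theorem genIn_mono (k : ℕ) : Monotone (genIn k) := by
  intro U V hUV g hg
  cases g with
  | x m η ν => exact fun ℓ => hUV (hg ℓ)
  | y η n => exact fun ℓ => hUV (hg ℓ)

theorem GU_mono (k : ℕ) : Monotone (GU k) :=
  fun _ _ hUV => AddSubgroup.closure_mono (Set.image_mono (genIn_mono k hUV))

/-- For every `U ⊆ 2^ω` and finite `u ⊆ 2^ω ∖ U`: `G_{U,u}` is contained in `G_{U∪u}`;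
moreover `G_{U,u}` is a pure subgroup of `G_{U∪u}`, and `G_{U∪u}` is a pure subgroup
of `G_k`. -/
theorem GUu_le_and_pure (k : ℕ) (U u : Set (ℕ → Bool)) (hufin : u.Finite)
    (hdisj : Disjoint u U) :
    GUu k U u ≤ GU k (U ∪ u) ∧
    (∀ (n : ℤ), ∀ h ∈ GUu k U u, (∃ g ∈ GU k (U ∪ u), h = n • g) →
      ∃ h' ∈ GUu k U u, h = n • h') ∧
    (∀ (n : ℤ), ∀ h ∈ GU k (U ∪ u), (∃ g : Gk k, h = n • g) →
      ∃ h' ∈ GU k (U ∪ u), h = n • h') := by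
  refine ⟨iSup₂_le fun η _ => GU_mono k (Set.union_subset_union_right U Set.sdiff_subset), ?_, ?_⟩
  · rintro n _ hh ⟨g, -, rfl⟩
    rw [GUu_eq_closure] at hh ⊢
    exact (Saturated.biUnion fun η => saturated_genIn k _).pure_closure n hh
  · rintro n _ hh ⟨g, rfl⟩
    exact (saturated_genIn k _).pure_closure n hh
end

section
/- If U ⊆ 2^ω has cardinality at least ℵ_{k+1}, then the subgroup G_U of G_k is not a free abelian group. -/
/-- A sequence of integers with `n! * c (n + 1) = c n` for all `n` starts with `0`. -/
theorem eq_zero_of_factorial_mul_succ_eq (c : ℕ → ℤ)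
    (hc : ∀ n, (n.factorial : ℤ) * c (n + 1) = c n) : c 0 = 0 := by
  by_contra h0
  have hne : ∀ n, c n ≠ 0 := by
    intro n
    induction n with
    | zero => exact h0
    | succ n ih =>
      intro h
      exact ih (by rw [← hc n, h, mul_zero])
  have hle : ∀ n, (c (n + 2)).natAbs + n ≤ (c 2).natAbs := by
    intro n
    induction n with
    | zero => simp
    | succ n ih =>
      have h1 : (c (n + 2)).natAbs = (n + 2).factorial * (c (n + 3)).natAbs := by
        rw [← hc (n + 2), Int.natAbs_mul, Int.natAbs_natCast]
      have h2 : 2 ≤ (n + 2).factorial := le_trans (by omega) (Nat.self_le_factorial (n + 2))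
      have h3 : 0 < (c (n + 3)).natAbs := Int.natAbs_pos.mpr (hne _)
      have h4 : 2 * (c (n + 3)).natAbs ≤ (n + 2).factorial * (c (n + 3)).natAbs :=
        Nat.mul_le_mul_right _ h2
      change (c (n + 3)).natAbs + (n + 1) ≤ _
      omega
  have := hle ((c 2).natAbs + 1)
  omega

open Cardinal in
/-- Kuratowski's free set theorem for tuples: if `#α ≥ ℵ_n` and each `F m η` is a countable set
depending only on the coordinates of `η` other than `m`, then some `η : Fin n → α` satisfies
`η m ∉ F m η` for all `m`. -/
theorem exists_forall_notMem_of_aleph_le (n : ℕ) {α : Type} (hα : aleph n ≤ #α)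
    (F : Fin n → (Fin n → α) → Set α) (hF : ∀ m η, (F m η).Countable)
    (hdep : ∀ m η η', (∀ l, l ≠ m → η l = η' l) → F m η = F m η') :
    ∃ η : Fin n → α, ∀ m, η m ∉ F m η := by
  induction n generalizing α with
  | zero => exact ⟨Fin.elim0, fun m => m.elim0⟩
  | succ n ih =>
    have hlt : aleph n < #α :=
      lt_of_lt_of_le (aleph_lt_aleph.mpr (by exact_mod_cast Nat.lt_succ_self n)) hα
    obtain ⟨A, hA⟩ := le_mk_iff_exists_set.mp hlt.le
    obtain ⟨a₀⟩ : Nonempty α := mk_ne_zero_iff.mp (ne_bot_of_gt hlt)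
    obtain ⟨a, ha⟩ : ∃ a, a ∉ ⋃ s : Fin n → A, F 0 (Fin.cons a₀ fun l => (s l : α)) := by
      by_contra! h
      refine hlt.not_ge ?_
      rw [← mk_univ, ← Set.eq_univ_of_forall h]
      have hs : #(Fin n → A) ≤ aleph n := by
        rw [mk_arrow, lift_id, lift_id, hA, mk_fin]
        exact power_nat_le (aleph0_le_aleph _)
      refine (mk_iUnion_le_sum_mk.trans (sum_le_mk_mul_iSup _)).trans ?_
      refine (mul_le_mul' hs (ciSup_le' fun s => ?_ : _ ≤ ℵ₀)).trans ?_
      · exact (hF _ _).le_aleph0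
      · exact (mul_le_max_of_aleph0_le_left (aleph0_le_aleph _)).trans
          (max_le le_rfl (aleph0_le_aleph _))
    obtain ⟨s, hs⟩ := ih (α := A) hA.ge
      (fun m s => Subtype.val ⁻¹' F m.succ (Fin.cons a fun l => (s l : α)))
      (fun m s => (hF _ _).preimage Subtype.val_injective)
      (fun m s s' h => by
        congr 1
        refine hdep _ _ _ fun l hl => ?_
        induction l using Fin.cases with
        | zero => rfl
        | succ l =>
          simp only [Fin.cons_succ]
          rw [h l fun e => hl (by rw [e])])
    refine ⟨Fin.cons a fun l => (s l : α), fun m => ?_⟩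
    induction m using Fin.cases with
    | zero =>
      intro h
      refine ha (Set.mem_iUnion.mpr ⟨s, ?_⟩)
      rw [hdep 0 _ (Fin.cons a fun l => (s l : α))]
      · exact h
      · intro l hl
        induction l using Fin.cases with
        | zero => exact absurd rfl hl
        | succ l => simp
    | succ m => exact hs m

theorem GU_mono_s16 (k : ℕ) {U V : Set (ℕ → Bool)} (h : U ⊆ V) : GU k U ≤ GU k V := by
  refine AddSubgroup.closure_mono (Set.image_mono ?_)
  rintro (⟨m, η, ν⟩ | ⟨η, n⟩) hg
  · exact fun l => h (hg l)
  · exact fun l => h (hg l)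

theorem genMk_mem_GU {k : ℕ} {U : Set (ℕ → Bool)} {g : Gen k} (hg : g ∈ genIn k U) :
    genMk k g ∈ GU k U :=
  AddSubgroup.subset_closure ⟨g, hg, rfl⟩

/-- Every element of `G_U` lies in `G_T` for some finite `T`. -/
theorem exists_finite_mem_GU {k : ℕ} {U : Set (ℕ → Bool)} {z : Gk k} (hz : z ∈ GU k U) :
    ∃ T : Set (ℕ → Bool), T.Finite ∧ z ∈ GU k T := by
  induction hz using AddSubgroup.closure_induction with
  | mem z hz =>
    obtain ⟨g, -, rfl⟩ := hz
    rcases g with ⟨m, η, ν⟩ | ⟨η, n⟩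
    · exact ⟨Set.range η, Set.finite_range η, genMk_mem_GU fun l => ⟨l, rfl⟩⟩
    · exact ⟨Set.range η, Set.finite_range η, genMk_mem_GU fun l => ⟨l, rfl⟩⟩
  | zero => exact ⟨∅, Set.finite_empty, zero_mem _⟩
  | add z w _ _ hz hw =>
    obtain ⟨T, hT, hz⟩ := hz
    obtain ⟨T', hT', hw⟩ := hw
    exact ⟨T ∪ T', hT.union hT', add_mem (GU_mono_s16 k Set.subset_union_left hz)
      (GU_mono_s16 k Set.subset_union_right hw)⟩
  | neg z _ hz =>
    obtain ⟨T, hT, hz⟩ := hz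
    exact ⟨T, hT, neg_mem hz⟩

theorem factorial_smul_genMk_y (k : ℕ) (η : Fin (k + 1) → ℕ → Bool) (n : ℕ) :
    (n.factorial : ℤ) • genMk k (.y η (n + 1)) = genMk k (.y η n) +
      ∑ m : Fin (k + 1), genMk k (.x m (fun l => η l.1) ((List.range n).map (η m))) := by
  have h : QuotientAddGroup.mk' (relSubgroup k) (relGk k η n) = 0 :=
    (QuotientAddGroup.eq_zero_iff _).mpr (AddSubgroup.subset_closure ⟨η, n, rfl⟩)
  rw [relGk, map_sub, map_sub, map_zsmul, map_sum, sub_sub, sub_eq_zero] at h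
  exact h

/-- There is a homomorphism `G_k → ℚ` that does not vanish at `y_{η̄,0}` and kills every generator
other than the `y_{η̄,n}`. -/
theorem exists_hom_genMk_y_ne_zero (k : ℕ) (η : Fin (k + 1) → ℕ → Bool) :
    ∃ φ : Gk k →+ ℚ, φ (genMk k (.y η 0)) ≠ 0 ∧
      ∀ g, (∀ n, g ≠ .y η n) → φ (genMk k g) = 0 := by
  classical
  let v : Gen k → ℚ := fun g => match g with
    | .x _ _ _ => 0
    | .y η' n => if η' = η then (∏ j ∈ Finset.range n, (j.factorial : ℚ))⁻¹ else 0
  have hker : relSubgroup k ≤ (FreeAbelianGroup.lift v).ker := by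
    refine (AddSubgroup.closure_le _).mpr ?_
    rintro _ ⟨η', n, rfl⟩
    rw [SetLike.mem_coe, AddMonoidHom.mem_ker, relGk, map_sub, map_sub, map_zsmul, map_sum]
    simp only [FreeAbelianGroup.lift_apply_of, v, Finset.sum_const_zero, sub_zero]
    split_ifs with h
    · rw [Finset.prod_range_succ, mul_inv, zsmul_eq_mul, Int.cast_natCast, sub_eq_zero]
      have : (n.factorial : ℚ) ≠ 0 := by exact_mod_cast n.factorial_ne_zero
      field_simp
    · simp
  have hφ : ∀ g, QuotientAddGroup.lift _ (FreeAbelianGroup.lift v) hker (genMk k g) = v g :=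
    fun g => FreeAbelianGroup.lift_apply_of v g
  refine ⟨QuotientAddGroup.lift _ (FreeAbelianGroup.lift v) hker, ?_, fun g hg => ?_⟩
  · rw [hφ]
    simp [v]
  · rw [hφ]
    rcases g with ⟨m, η', ν⟩ | ⟨η', n⟩
    · rfl
    · exact if_neg fun h => hg n (by rw [h])

/-- If `U ⊆ 2^ω` has cardinality at least `ℵ_{k+1}`, then the subgroup `G_U` of `G_k` is
not a free abelian group. -/
theorem GU_not_free_of_large (k : ℕ) (U : Set (ℕ → Bool))
    (hU : Cardinal.aleph (k + 1) ≤ Cardinal.mk U) :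
    ¬ Module.Free ℤ (GU k U) := by
  intro hfree
  let b := Module.Free.chooseBasis ℤ (GU k U)
  choose T hTfin hT using fun i => exists_finite_mem_GU (b i).2
  let X (m : Fin (k + 1)) (η : Fin (k + 1) → U) (ν : List Bool) : GU k U :=
    ⟨genMk k (.x m (fun l => (η l.1 : ℕ → Bool)) ν), genMk_mem_GU fun l => (η l.1).2⟩
  let Y (η : Fin (k + 1) → U) (n : ℕ) : GU k U :=
    ⟨genMk k (.y (fun l => (η l : ℕ → Bool)) n), genMk_mem_GU fun l => (η l).2⟩
  obtain ⟨η, hη⟩ := exists_forall_notMem_of_aleph_le (k + 1) (α := U) (by exact_mod_cast hU)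
    (fun m η => Subtype.val ⁻¹' ⋃ ν : List Bool, ⋃ i ∈ (b.repr (X m η ν)).support, T i)
    (fun m η => by
      refine Set.Countable.preimage ?_ Subtype.val_injective
      exact Set.countable_iUnion fun ν =>
        (Finset.countable_toSet _).biUnion fun i _ => (hTfin i).countable)
    (fun m η η' h => by
      have hX : X m η = X m η' := by
        funext ν
        have : (fun l : {l // l ≠ m} => (η l.1 : ℕ → Bool)) = fun l => (η' l.1 : ℕ → Bool) :=
          funext fun l => by rw [h l.1 l.2]
        simp only [X, this]
      simp only [hX])
  have hrel (n : ℕ) : (n.factorial : ℤ) • Y η (n + 1) = Y η n +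
      ∑ m : Fin (k + 1), X m η ((List.range n).map (η m : ℕ → Bool)) := by
    apply Subtype.ext
    simpa [X, Y] using factorial_smul_genMk_y k (fun l => (η l : ℕ → Bool)) n
  have hsupp : ∀ i ∈ (b.repr (Y η 0)).support, ∃ m, (η m : ℕ → Bool) ∉ T i := by
    intro i hi
    by_contra! hmem
    refine Finsupp.mem_support_iff.mp hi
      (eq_zero_of_factorial_mul_succ_eq (fun n => b.repr (Y η n) i) fun n => ?_)
    have hX (m : Fin (k + 1)) (ν : List Bool) : b.coord i (X m η ν) = 0 := by
      by_contra hne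
      exact hη m (Set.mem_iUnion.mpr
        ⟨ν, Set.mem_biUnion (Finset.mem_coe.mpr (Finsupp.mem_support_iff.mpr hne)) (hmem m)⟩)
    have := congrArg (b.coord i) (hrel n)
    rw [map_add, map_sum, Finset.sum_eq_zero fun m _ => hX m _, add_zero, map_zsmul] at this
    exact this
  obtain ⟨φ, hφ0, hφ⟩ := exists_hom_genMk_y_ne_zero k fun l => (η l : ℕ → Bool)
  have hφT (m : Fin (k + 1)) (V : Set (ℕ → Bool)) (hm : (η m : ℕ → Bool) ∉ V) :
      GU k V ≤ φ.ker := by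
    refine (AddSubgroup.closure_le _).mpr ?_
    rintro _ ⟨g, hg, rfl⟩
    refine hφ g fun n h => ?_
    subst h
    exact hm (hg m)
  refine hφ0 ?_
  change (φ.comp (GU k U).subtype) (Y η 0) = 0
  rw [← b.linearCombination_repr (Y η 0), Finsupp.linearCombination_apply, Finsupp.sum, map_sum]
  refine Finset.sum_eq_zero fun i hi => ?_
  obtain ⟨m, hm⟩ := hsupp i hi
  rw [map_zsmul]
  exact smul_eq_zero_of_right _ (hφT m (T i) hm (hT i))
end

section
/- For every natural number k, the abelian group G_k embeds purely into the Baer–Specker group ℤ^ℕ: there is an injective group homomorphism from G_k into the product ∏_{n∈ℕ} ℤ whose image is a pure subgroup of ℤ^ℕ. -/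
/-- The initial segment of `η` of length `N`. -/
def initSeg (N : ℕ) (η : ℕ → Bool) : List Bool := (List.range N).map η

theorem length_initSeg (N : ℕ) (η : ℕ → Bool) : (initSeg N η).length = N := by
  simp [initSeg]

theorem initSeg_eq_iff {N : ℕ} {η η' : ℕ → Bool} :
    initSeg N η = initSeg N η' ↔ ∀ i < N, η i = η' i := by
  simp [initSeg, List.map_inj_left]

/-- Finitely many elements of `2^ω` are separated by their initial segments of length `N`,
for all large `N`. -/
theorem exists_forall_injOn_initSeg (E : Finset (ℕ → Bool)) :
    ∃ N₀, ∀ N ≥ N₀, Set.InjOn (initSeg N) (E : Set (ℕ → Bool)) := by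
  have h : ∀ p : (ℕ → Bool) × (ℕ → Bool), ∃ i, p.1 ≠ p.2 → p.1 i ≠ p.2 i := by
    intro p
    by_cases hp : p.1 = p.2
    · exact ⟨0, fun h => absurd hp h⟩
    · obtain ⟨i, hi⟩ := Function.ne_iff.1 hp
      exact ⟨i, fun _ => hi⟩
  choose d hd using h
  refine ⟨(E ×ˢ E).sup d + 1, fun N hN η hη η' hη' hEq => ?_⟩
  by_contra hne
  have hle : d (η, η') ≤ (E ×ˢ E).sup d :=
    Finset.le_sup (Finset.mem_product.2 ⟨hη, hη'⟩)
  exact hd (η, η') hne (initSeg_eq_iff.1 hEq _ (by omega))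

/-- The finite data left of a generator `x_{m,η̄,ν}` when `η̄` is cut down to initial
segments. -/
abbrev TruncGen (k : ℕ) : Type :=
  Σ m : Fin (k + 1), ({ℓ : Fin (k + 1) // ℓ ≠ m} → List Bool) × List Bool

/-- The truncation of `x_{m,η̄,ν}` with `η̄` cut down to length `M`. -/
def truncX {k : ℕ} (M : ℕ) (m : Fin (k + 1))
    (η : {ℓ : Fin (k + 1) // ℓ ≠ m} → ℕ → Bool) (ν : List Bool) : TruncGen k :=
  ⟨m, fun ℓ => initSeg M (η ℓ), ν⟩

open Classical in
/-- The indicator of the generators `x_{m,η̄,ν}` with truncation `t`. -/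
noncomputable def indX {k : ℕ} (M : ℕ) (t : TruncGen k) (m : Fin (k + 1))
    (η : {ℓ : Fin (k + 1) // ℓ ≠ m} → ℕ → Bool) (ν : List Bool) : ℤ :=
  if truncX M m η ν = t then 1 else 0

theorem indX_eq_zero_of_length_ne {k : ℕ} {M : ℕ} {t : TruncGen k} {m : Fin (k + 1)}
    {η : {ℓ : Fin (k + 1) // ℓ ≠ m} → ℕ → Bool} {ν : List Bool}
    (h : ν.length ≠ t.2.2.length) : indX M t m η ν = 0 := by
  refine if_neg ?_
  rintro rfl
  exact h rfl

/-- The sum over `m ≤ k` of the values of `indX` at `x_{m,η̄,η_m↾n}`. -/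
noncomputable def sumX {k : ℕ} (M : ℕ) (t : TruncGen k) (η : Fin (k + 1) → ℕ → Bool)
    (n : ℕ) : ℤ :=
  ∑ m, indX M t m (fun ℓ => η ℓ.1) (initSeg n (η m))

theorem sumX_eq_zero_of_ne {k : ℕ} {M : ℕ} {t : TruncGen k} {η : Fin (k + 1) → ℕ → Bool}
    {n : ℕ} (h : n ≠ t.2.2.length) : sumX M t η n = 0 :=
  Finset.sum_eq_zero fun _ _ => indX_eq_zero_of_length_ne (by rwa [length_initSeg])

/-- The values on the generators of the homomorphism `G_k → ℤ` extending `indX`. -/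
noncomputable def genVal {k : ℕ} (M : ℕ) (t : TruncGen k) : Gen k → ℤ
  | .x m η ν => indX M t m η ν
  | .y η n => if n ≤ t.2.2.length then
      -((∏ i ∈ Finset.Ico n t.2.2.length, (i.factorial : ℤ)) * sumX M t η t.2.2.length) else 0

theorem lift_genVal_relGk {k : ℕ} (M : ℕ) (t : TruncGen k) (η : Fin (k + 1) → ℕ → Bool)
    (n : ℕ) : FreeAbelianGroup.lift (genVal M t) (relGk k η n) = 0 := by
  have hX : ∑ m, genVal M t (Gen.x m (fun ℓ => η ℓ.1) ((List.range n).map (η m))) =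
      sumX M t η n := rfl
  simp only [relGk, map_sub, map_zsmul, map_sum, FreeAbelianGroup.lift_apply_of, hX]
  rcases lt_trichotomy n t.2.2.length with h | h | h
  · rw [sumX_eq_zero_of_ne h.ne]
    simp only [genVal, if_pos h.le, if_pos (Nat.succ_le_of_lt h)]
    rw [Finset.prod_eq_prod_Ico_succ_bot h, smul_eq_mul]
    ring
  · subst h
    simp [genVal]
  · rw [sumX_eq_zero_of_ne h.ne']
    simp [genVal, h.not_ge, show ¬ n + 1 ≤ t.2.2.length by omega]

/-- The homomorphism `G_k → ℤ` extending `indX`. -/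
noncomputable def truncHom {k : ℕ} (M : ℕ) (t : TruncGen k) : Gk k →+ ℤ :=
  QuotientAddGroup.lift (relSubgroup k) (FreeAbelianGroup.lift (genVal M t)) (by
    rw [relSubgroup, AddSubgroup.closure_le]
    rintro _ ⟨η, n, rfl⟩
    exact lift_genVal_relGk M t η n)

theorem truncHom_genMk {k : ℕ} (M : ℕ) (t : TruncGen k) (g : Gen k) :
    truncHom M t (genMk k g) = genVal M t g := by
  simp [truncHom, genMk]

/-- The generators with indices in `E` which are `x_{m,η̄,ν}` with `ν` shorter than `N`, or
`y_{η̄,N}`. -/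
def levelGen (k N : ℕ) (E : Set (ℕ → Bool)) : Set (Gen k) :=
  {g | g ∈ genIn k E ∧ match g with
    | .x _ _ ν => ν.length < N
    | .y _ n => n = N}

/-- The subgroup of `G_k` generated by `levelGen k N E`. -/
def levelSpan (k N : ℕ) (E : Set (ℕ → Bool)) : Submodule ℤ (Gk k) :=
  Submodule.span ℤ (genMk k '' levelGen k N E)

theorem genMk_y_eq {k : ℕ} (η : Fin (k + 1) → ℕ → Bool) (n : ℕ) :
    genMk k (.y η n) = (n.factorial : ℤ) • genMk k (.y η (n + 1)) -
      ∑ m, genMk k (.x m (fun ℓ => η ℓ.1) (initSeg n (η m))) := by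
  have h : (QuotientAddGroup.mk' (relSubgroup k)) (relGk k η n) = 0 :=
    (QuotientAddGroup.eq_zero_iff _).2 (AddSubgroup.subset_closure ⟨η, n, rfl⟩)
  simp only [relGk, map_sub, map_zsmul, map_sum] at h
  have h' : (n.factorial : ℤ) • genMk k (.y η (n + 1)) - genMk k (.y η n) -
      ∑ m, genMk k (.x m (fun ℓ => η ℓ.1) (initSeg n (η m))) = 0 := h
  rw [← sub_eq_zero, ← neg_eq_zero, ← h']
  abel

theorem levelSpan_le_succ (k N : ℕ) (E : Set (ℕ → Bool)) :
    levelSpan k N E ≤ levelSpan k (N + 1) E := by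
  refine Submodule.span_le.2 ?_
  rintro _ ⟨g, ⟨hE, hN⟩, rfl⟩
  cases g with
  | x m η ν =>
    exact Submodule.subset_span ⟨_, ⟨hE, Nat.lt_succ_of_lt hN⟩, rfl⟩
  | y η n =>
    obtain rfl : n = N := hN
    rw [genMk_y_eq]
    have hy : Gen.y η (n + 1) ∈ levelGen k (n + 1) E := ⟨fun ℓ => hE ℓ, rfl⟩
    have hx (m : Fin (k + 1)) :
        Gen.x m (fun ℓ => η ℓ.1) (initSeg n (η m)) ∈ levelGen k (n + 1) E :=
      ⟨fun ℓ => hE ℓ.1, by simp [length_initSeg]⟩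
    exact sub_mem (Submodule.smul_mem _ _ (Submodule.subset_span ⟨_, hy, rfl⟩))
      (sum_mem fun m _ => Submodule.subset_span ⟨_, hx m, rfl⟩)

theorem levelSpan_mono {k N N' : ℕ} {E E' : Set (ℕ → Bool)} (hN : N ≤ N') (hE : E ⊆ E') :
    levelSpan k N E ≤ levelSpan k N' E' := by
  refine (monotone_nat_of_le_succ (fun n => levelSpan_le_succ k n E) hN).trans
    (Submodule.span_mono (Set.image_mono ?_))
  rintro (⟨m, η, ν⟩ | ⟨η, n⟩) ⟨h, h'⟩
  · exact ⟨fun ℓ => hE (h ℓ), h'⟩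
  · exact ⟨fun ℓ => hE (h ℓ), h'⟩

open Classical in
theorem exists_mem_levelSpan {k : ℕ} (g : Gk k) :
    ∃ (N : ℕ) (E : Finset (ℕ → Bool)), g ∈ levelSpan k N E := by
  obtain ⟨a, rfl⟩ := QuotientAddGroup.mk_surjective g
  have hof : ∀ s : Gen k, ∃ (N : ℕ) (E : Finset (ℕ → Bool)), genMk k s ∈ levelSpan k N E := by
    rintro (⟨m, η, ν⟩ | ⟨η, n⟩)
    · exact ⟨ν.length + 1, Finset.univ.image η, Submodule.subset_span
        ⟨_, ⟨fun ℓ => by simp, Nat.lt_succ_self _⟩, rfl⟩⟩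
    · exact ⟨n, Finset.univ.image η, Submodule.subset_span ⟨_, ⟨fun ℓ => by simp, rfl⟩, rfl⟩⟩
  induction a using FreeAbelianGroup.induction_on with
  | zero => exact ⟨0, ∅, zero_mem _⟩
  | of s => exact hof s
  | neg s _ =>
    obtain ⟨N, E, h⟩ := hof s
    exact ⟨N, E, neg_mem h⟩
  | add a b ha hb =>
    obtain ⟨N, E, h⟩ := ha
    obtain ⟨N', E', h'⟩ := hb
    exact ⟨max N N', E ∪ E', add_mem
      (levelSpan_mono (le_max_left _ _) (by simp) h)
      (levelSpan_mono (le_max_right _ _) (by simp) h')⟩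

theorem eq_of_truncX_eq {k N : ℕ} {E : Set (ℕ → Bool)} (hE : Set.InjOn (initSeg N) E)
    {m m' : Fin (k + 1)} {η : {ℓ : Fin (k + 1) // ℓ ≠ m} → ℕ → Bool}
    {η' : {ℓ : Fin (k + 1) // ℓ ≠ m'} → ℕ → Bool} {ν ν' : List Bool}
    (hη : ∀ ℓ, η ℓ ∈ E) (hη' : ∀ ℓ, η' ℓ ∈ E) (h : truncX N m η ν = truncX N m' η' ν') :
    Gen.x m η ν = Gen.x m' η' ν' := by
  obtain rfl : m = m' := congrArg Sigma.fst h
  have h₂ := eq_of_heq (Sigma.mk.inj h).2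
  obtain rfl : ν = ν' := congrArg Prod.snd h₂
  obtain rfl : η = η' := funext fun ℓ => hE (hη ℓ) (hη' ℓ) (congrFun (congrArg Prod.fst h₂) ℓ)
  rfl

open Classical in
theorem sumX_truncX {k N : ℕ} {E : Set (ℕ → Bool)} (hE : Set.InjOn (initSeg N) E)
    {η η' : Fin (k + 1) → ℕ → Bool} (hη : ∀ ℓ, η ℓ ∈ E) (hη' : ∀ ℓ, η' ℓ ∈ E) :
    sumX N (truncX N 0 (fun ℓ => η ℓ.1) (initSeg N (η 0))) η' N = if η' = η then 1 else 0 := by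
  rw [sumX, Finset.sum_eq_single 0]
  · refine if_congr ⟨fun h => ?_, fun h => by rw [h]⟩ rfl rfl
    have h₂ := eq_of_heq (Sigma.mk.inj h).2
    funext ℓ
    refine hE (hη' ℓ) (hη ℓ) ?_
    by_cases hℓ : ℓ = 0
    · subst hℓ
      exact congrArg Prod.snd h₂
    · exact congrFun (congrArg Prod.fst h₂) ⟨ℓ, hℓ⟩
  · exact fun m _ hm => if_neg fun h => hm (congrArg Sigma.fst h)
  · simp

open Classical in
/-- Up to sign, the coordinate functions of the family `levelGen k N E` extend to some
`truncHom M t`. -/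
theorem exists_genVal_eq {k N : ℕ} {E : Set (ℕ → Bool)} (hE : Set.InjOn (initSeg N) E)
    {s : Gen k} (hs : s ∈ levelGen k N E) :
    ∃ (t : TruncGen k) (ε : ℤ), IsUnit ε ∧
      ∀ s' ∈ levelGen k N E, genVal N t s' = if s' = s then ε else 0 := by
  cases s with
  | x m η ν =>
    refine ⟨truncX N m η ν, 1, isUnit_one, ?_⟩
    rintro (⟨m', η', ν'⟩ | ⟨η', n⟩) ⟨hs', hN⟩
    · exact if_congr ⟨eq_of_truncX_eq hE hs' hs.1, fun h => by cases h; rfl⟩ rfl rfl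
    · obtain rfl : n = N := hN
      rw [if_neg (by simp)]
      exact if_neg (not_le.2 hs.2)
  | y η n =>
    obtain rfl : n = N := hs.2
    refine ⟨truncX n 0 (fun ℓ => η ℓ.1) (initSeg n (η 0)), -1, isUnit_one.neg, ?_⟩
    have hlen : (truncX n 0 (fun ℓ => η ℓ.1) (initSeg n (η 0))).2.2.length = n :=
      length_initSeg n (η 0)
    rintro (⟨m', η', ν'⟩ | ⟨η', n'⟩) ⟨hs', hN⟩
    · rw [if_neg (by simp)]
      exact indX_eq_zero_of_length_ne (by rw [hlen]; exact ne_of_lt hN)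
    · obtain rfl : n' = n := hN
      simp only [genVal, hlen, sumX_truncX hE hs.1 hs', Gen.y.injEq, and_true]
      split_ifs <;> simp_all

/-- Divisibility by `n` in `G_k`, including `n = 0`, is detected by the homomorphisms
`truncHom M t`. -/
theorem exists_eq_zsmul_of_forall_dvd {k : ℕ} {n : ℤ} {g : Gk k}
    (h : ∀ M (t : TruncGen k), n ∣ truncHom M t g) : ∃ g', g = n • g' := by
  classical
  obtain ⟨N₀, E, hg⟩ := exists_mem_levelSpan g
  obtain ⟨N₁, hN₁⟩ := exists_forall_injOn_initSeg E
  have hE := hN₁ (max N₀ N₁) (le_max_right _ _)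
  replace hg := levelSpan_mono (le_max_left N₀ N₁) (le_refl (E : Set (ℕ → Bool))) hg
  generalize max N₀ N₁ = N at hE hg
  obtain ⟨c, hc, rfl⟩ := (Finsupp.mem_span_image_iff_linearCombination ℤ).1 hg
  have hdvd : ∀ s ∈ c.support, n ∣ c s := by
    intro s hs
    obtain ⟨t, ε, hε, ht⟩ := exists_genVal_eq hE (hc hs)
    have hval : truncHom N t (Finsupp.linearCombination ℤ (genMk k) c) = c s * ε := by
      rw [Finsupp.linearCombination_apply, Finsupp.sum, map_sum, Finset.sum_eq_single_of_mem s hs]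
      · rw [map_zsmul, truncHom_genMk, ht s (hc hs), if_pos rfl, smul_eq_mul]
      · intro s' hs' hne
        rw [map_zsmul, truncHom_genMk, ht s' (hc hs'), if_neg hne, smul_zero]
    exact hε.dvd_mul_right.1 (hval ▸ h N t)
  refine ⟨∑ s ∈ c.support, (c s / n) • genMk k s, ?_⟩
  rw [Finsupp.linearCombination_apply, Finsupp.sum, Finset.smul_sum]
  refine Finset.sum_congr rfl fun s hs => ?_
  rw [smul_smul, Int.mul_ediv_cancel' (hdvd s hs)]

/-- `G_k` embeds purely into the Baer–Specker group `ℤ^ℕ`: there is an injective group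
homomorphism from `G_k` into `∏_{n∈ℕ} ℤ` whose image is a pure subgroup. -/
theorem Gk_pure_embedding_specker (k : ℕ) :
    ∃ f : Gk k →+ (ℕ → ℤ), Function.Injective f ∧
      ∀ (n : ℤ), ∀ x ∈ f.range, (∃ g : ℕ → ℤ, x = n • g) →
        ∃ y ∈ f.range, x = n • y := by
  have : Nonempty (ℕ × TruncGen k) := ⟨(0, ⟨0, fun _ => [], []⟩)⟩
  obtain ⟨e, he⟩ := exists_surjective_nat (ℕ × TruncGen k)
  let f : Gk k →+ (ℕ → ℤ) := AddMonoidHom.pi fun i => truncHom (e i).1 (e i).2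
  have key : ∀ (n : ℤ) (a : Gk k), (∃ g : ℕ → ℤ, f a = n • g) → ∃ b, a = n • b := by
    rintro n a ⟨g, hg⟩
    refine exists_eq_zsmul_of_forall_dvd fun M t => ?_
    obtain ⟨i, hi⟩ := he (M, t)
    refine ⟨g i, ?_⟩
    have := congrFun hg i
    simpa [f, hi] using this
  refine ⟨f, (injective_iff_map_eq_zero f).2 fun a ha => ?_, ?_⟩
  · obtain ⟨b, hb⟩ := key 0 a ⟨0, by simp [ha]⟩
    simpa using hb
  · rintro n _ ⟨a, rfl⟩ h
    obtain ⟨b, rfl⟩ := key n a h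
    exact ⟨f b, ⟨b, rfl⟩, map_zsmul f n b⟩
end
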